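/- Commutator rotation numbers, rational case: let f, g ∈ Homeo_ℤ(ℝ) and suppose τ(f) = p/q where p, q are coprime integers with q > 0. Then τ([f,g]) ≤ 1/q, where [f,g] = f∘g∘f⁻¹∘g⁻¹. In particular, τ([f,g]) ≤ 1 for all f, g ∈ Homeo_ℤ(ℝ). -/

import Mathlib

open CircleDeg1Lift

namespace CircleDeg1Lift

/-- The sum of the first `q` iterates of `h`: up to normalization, it conjugates `h` to a map which
moves every point by at least `1 / q` as soon as `h ^ q` moves every point by at least `1`. -/
noncomputable def iterateSum (h : CircleDeg1Lift) (q : ℕ) (x : ℝ) : ℝ :=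
  ∑ i ∈ Finset.range q, (h ^ i) x

theorem iterateSum_monotone (h : CircleDeg1Lift) (q : ℕ) : Monotone (h.iterateSum q) :=
  fun _ _ hxy => Finset.sum_le_sum fun i _ => (h ^ i).mono hxy

theorem iterateSum_add_int (h : CircleDeg1Lift) (q : ℕ) (x : ℝ) (m : ℤ) :
    h.iterateSum q (x + m) = h.iterateSum q x + q * m := by
  simp [iterateSum, Finset.sum_add_distrib]

theorem iterateSum_map (h : CircleDeg1Lift) (q : ℕ) (x : ℝ) :
    h.iterateSum q (h x) = h.iterateSum q x + ((h ^ q) x - x) := by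
  have key := Finset.sum_range_succ' (fun i => (h ^ i) x) q
  rw [Finset.sum_range_succ] at key
  simp only [pow_succ, mul_apply, pow_zero, coe_one, id] at key
  simp only [iterateSum]
  linarith

theorem pow_mul_map_eq {k : CircleDeg1Lift} {q : ℕ} {p : ℤ} {x : ℝ} (hx : (k ^ q) x = x + p)
    (n : ℕ) : (k ^ (q * n)) x = x + n * p := by
  rw [pow_mul, coe_pow]
  exact iterate_eq_of_map_eq_add_int _ hx n

/-- A point `y` with `(s ^ q) y = y + 1` can be moved, by a power of `s` and an integer
translation, so that it and its image under `s` enclose a given point. -/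
theorem exists_pow_add_int_le_lt {s : CircleDeg1Lift} {q : ℕ} {y : ℝ} (hy : (s ^ q) y = y + 1)
    (z : ℝ) : ∃ (j : ℕ) (m : ℤ), (s ^ j) y + m ≤ z ∧ z < (s ^ (j + 1)) y + m := by
  classical
  set m : ℤ := ⌊z - y⌋
  have hm : y + m ≤ z := by linarith [Int.floor_le (z - y)]
  have hex : ∃ j : ℕ, z < (s ^ j) y + m := by
    refine ⟨q, ?_⟩
    rw [hy]
    linarith [Int.lt_floor_add_one (z - y)]
  obtain ⟨j, hj⟩ : ∃ j, Nat.find hex = j + 1 := by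
    refine Nat.exists_eq_succ_of_ne_zero fun h0 => ?_
    have := Nat.find_spec hex
    rw [h0, pow_zero, coe_one, id] at this
    exact this.not_ge hm
  refine ⟨j, m, not_lt.1 (Nat.find_min hex (by omega)), ?_⟩
  rw [← hj]
  exact Nat.find_spec hex

theorem exists_nat_int_bezout {p q : ℤ} (hq : 0 < q) (hcop : Int.gcd p q = 1) :
    ∃ (a : ℕ) (b : ℤ), 0 < a ∧ a * p + b * q = 1 := by
  have hb := Int.gcd_eq_gcd_ab p q
  rw [hcop] at hb
  set u := Int.gcdA p q
  have hmod := Int.emod_add_mul_ediv u q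
  have hnn := Int.emod_nonneg u hq.ne'
  refine ⟨(u % q + q).toNat, Int.gcdB p q + p * (u / q) - p, by omega, ?_⟩
  rw [Int.toNat_of_nonneg (by omega)]
  push_cast at hb
  linear_combination p * hmod - hb

/-- If `f` and `k` have the translation number `p / q` in lowest terms and `f = h * k`, then
the translation number of `h` is at most `1 / q`. -/
theorem translationNumber_le_of_mul_eq {f h k : CircleDeg1Lift} (hfk : f = h * k)
    (hfc : Continuous f) (hkc : Continuous k) {p : ℤ} {q : ℕ} (hq : 0 < q)
    (hcop : Int.gcd p q = 1) (hf : translationNumber f = p / q)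
    (hk : translationNumber k = p / q) : translationNumber h ≤ 1 / q := by
  by_contra! hlt
  have hq' : (0 : ℝ) < q := by exact_mod_cast hq
  have hmove (x : ℝ) : x + 1 < (h ^ q) x := by
    have h1 : ((1 : ℤ) : ℝ) < translationNumber (h ^ q) := by
      rw [translationNumber_pow, Int.cast_one]
      rwa [div_lt_iff₀' hq'] at hlt
    simpa using lt_map_of_int_lt_translationNumber _ h1 x
  set φ := h.iterateSum q
  have hφ : Monotone φ := h.iterateSum_monotone q
  have hφh (x : ℝ) : φ x + 1 < φ (h x) := by
    have := h.iterateSum_map q x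
    linarith [hmove x]
  have hkf : k ≤ f := fun x => by
    rw [hfk, mul_apply]
    by_contra! hc
    linarith [hφ hc.le, hφh (k x)]
  obtain ⟨y₀, hy₀⟩ := (translationNumber_eq_rat_iff k hkc hq).1 hk
  obtain ⟨z, hz⟩ := (translationNumber_eq_rat_iff f hfc hq).1 hf
  obtain ⟨a, b, ha, hab⟩ := exists_nat_int_bezout (Int.natCast_pos.2 hq) hcop
  have hab' : (a : ℝ) * p + b * q = 1 := by exact_mod_cast hab
  -- `s` maps each point of a periodic orbit of `k` to the next one.
  set t : CircleDeg1Lift := ↑(translate (Multiplicative.ofAdd (b : ℝ)))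
  set s : CircleDeg1Lift := t * k ^ a
  have ht (u : CircleDeg1Lift) : Commute t u := by
    ext x
    simp [t]
  have hspow (j : ℕ) (x : ℝ) : (s ^ j) x = (k ^ (a * j)) x + b * j := by
    have htj : (t ^ j) ((k ^ (a * j)) x) = (k ^ (a * j)) x + j * b := by
      rw [coe_pow]
      exact iterate_eq_of_map_eq_add_int _ (by simp [t, add_comm]) j
    rw [(ht (k ^ a)).mul_pow, ← pow_mul, mul_apply, htj, mul_comm (b : ℝ)]
  have hsk : Commute s k := (ht k).mul_left (Commute.pow_self k a)
  have hsq {x : ℝ} (hx : (k ^ q) x = x + p) : (s ^ q) x = x + 1 := by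
    rw [hspow, mul_comm a q, pow_mul_map_eq hx]
    linarith
  obtain ⟨j₀, m₀, hle, hlt'⟩ := exists_pow_add_int_le_lt (hsq hy₀) z
  obtain ⟨y, hy, hyz, hzy⟩ : ∃ y, (k ^ q) y = y + p ∧ y ≤ z ∧ z < s y := by
    refine ⟨(s ^ j₀) y₀ + m₀, ?_, hle, ?_⟩
    · rw [map_add_int, ← mul_apply, ← (hsk.pow_pow j₀ q).eq, mul_apply, hy₀, map_add_int]
      ring
    · rwa [map_add_int, ← mul_apply, ← pow_succ']
  have hsy : (k ^ q) (s y) = s y + p := by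
    rw [← mul_apply, ← (hsk.pow_right q).eq, mul_apply, hy, map_add_int]
  have hlow (n : ℕ) : (k ^ n) y ≤ (f ^ n) z := ((k ^ n).mono hyz).trans (pow_mono hkf n z)
  have hupp (n : ℕ) : (f ^ n) z < (k ^ n) (s y) := by
    by_contra! hc
    obtain ⟨r, hr⟩ := Nat.exists_eq_add_of_le (Nat.le_mul_of_pos_left n hq)
    have h1 := ((k ^ r).mono hc).trans (pow_mono hkf r _)
    rw [← mul_apply (k ^ r), ← mul_apply (f ^ r), ← pow_add, ← pow_add, add_comm r, ← hr, pow_mul_map_eq hsy,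
      pow_mul_map_eq hz] at h1
    linarith
  have hstep (n : ℕ) : φ ((k ^ (n + 1)) y) + 1 < φ ((k ^ (n + 1)) (s y)) := by
    have h1 : (f ^ (n + 1)) z = h (k ((f ^ n) z)) := by
      rw [pow_succ', mul_apply, hfk, mul_apply]
    have h2 : (k ^ (n + 1)) y ≤ k ((f ^ n) z) := by
      rw [pow_succ', mul_apply]
      exact k.mono (hlow n)
    have h3 := hφ (hupp (n + 1)).le
    rw [h1] at h3
    linarith [hφ h2, hφh (k ((f ^ n) z))]
  have hstep' (j : ℕ) : φ ((s ^ (j + 1)) y) + 1 < φ ((s ^ (j + 2)) y) := by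
    obtain ⟨n, hn⟩ := Nat.exists_eq_succ_of_ne_zero (Nat.mul_pos ha j.succ_pos).ne'
    have h1 := hstep n
    have h2 (x : ℝ) : φ ((s ^ (j + 1)) x) = φ ((k ^ (n + 1)) x) + q * (b * (j + 1 : ℕ) : ℤ) := by
      rw [← h.iterateSum_add_int, hspow, hn]
      push_cast
      rfl
    rw [show j + 2 = (j + 1) + 1 from rfl, pow_succ s (j + 1), mul_apply, h2, h2]
    linarith
  have hsum (j : ℕ) : φ (s y) + j ≤ φ ((s ^ (j + 1)) y) := by
    induction j with
    | zero => simp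
    | succ j ih =>
      push_cast
      linarith [hstep' j]
  obtain ⟨r, rfl⟩ := Nat.exists_eq_succ_of_ne_zero hq.ne'
  have h1 := hsum r
  have h2 := hstep' r
  rw [show r + 2 = (r + 1) + 1 from rfl, pow_succ s (r + 1), mul_apply, hsq hsy] at h2
  have h3 := h.iterateSum_add_int (r + 1) (s y) 1
  push_cast at h3
  linarith

theorem continuous_units (f : CircleDeg1Liftˣ) : Continuous (f : CircleDeg1Lift) :=
  (toOrderIso f).continuous

end CircleDeg1Lift

/-- Commutator rotation numbers, rational case: if `τ(f) = p/q` with `p, q` coprime and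
`q > 0`, then `τ([f,g]) ≤ 1/q`; in particular `τ([f,g]) ≤ 1` for all `f, g`. -/
theorem translationNumber_commutator_le (f g : CircleDeg1Liftˣ) (p q : ℤ)
    (hq : 0 < q) (hcop : Int.gcd p q = 1)
    (hf : translationNumber (f : CircleDeg1Lift) = (p : ℝ) / q) :
    translationNumber ((f * g * f⁻¹ * g⁻¹ : CircleDeg1Liftˣ) : CircleDeg1Lift) ≤ 1 / q ∧
      ∀ f' g' : CircleDeg1Liftˣ,
        translationNumber ((f' * g' * f'⁻¹ * g'⁻¹ : CircleDeg1Liftˣ) : CircleDeg1Lift) ≤ 1 := by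
  have hmul (f g : CircleDeg1Liftˣ) : (f : CircleDeg1Lift) =
      (f * g * f⁻¹ * g⁻¹ : CircleDeg1Liftˣ) * (g * f * g⁻¹ : CircleDeg1Liftˣ) := by
    rw [← Units.val_mul]
    congr 1
    group
  have hconj (f g : CircleDeg1Liftˣ) :
      translationNumber ((g * f * g⁻¹ : CircleDeg1Liftˣ) : CircleDeg1Lift) =
        translationNumber (f : CircleDeg1Lift) := translationNumber_conj_eq g f
  constructor
  · lift q to ℕ using hq.le
    exact translationNumber_le_of_mul_eq (hmul f g) (continuous_units _) (continuous_units _)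
      (Int.natCast_pos.1 hq) hcop hf ((hconj f g).trans hf)
  · intro f' g'
    by_contra! hlt
    set h : CircleDeg1Lift := ↑(f' * g' * f'⁻¹ * g'⁻¹)
    set k : CircleDeg1Lift := ↑(g' * f' * g'⁻¹)
    set t : CircleDeg1Lift := ↑(translate (Multiplicative.ofAdd (1 : ℝ)))
    have hle : t * k ≤ f' := fun x => by
      have := lt_map_of_int_lt_translationNumber h (n := 1) (by exact_mod_cast hlt) (k x)
      rw [hmul f' g', mul_apply, mul_apply, translate_apply]
      push_cast at this
      linarith
    have ht : Commute t k := by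
      ext x
      simp [t]
    have := translationNumber_mono hle
    rw [translationNumber_mul_of_commute ht, translationNumber_translate, hconj] at this
    linarith
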